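/- Suppose r = 2, so that Λ = O⟦t₁,t₂⟧ is a three-dimensional regular local ring. Then for every finitely generated Λ-module M, one has Ext^2_Λ(M*,Λ) = 0 and an isomorphism of Λ-modules Ext^1_Λ(M*,Λ) ≅ Ext^3_Λ(Ext^1_Λ(M,Λ),Λ); in particular, Ext^1_Λ(M*,Λ) is a module of finite cardinality. -/

import Mathlib

open CategoryTheory Opposite

set_option maxHeartbeats 1000000
set_option synthInstance.maxHeartbeats 400000

noncomputable section

/-- The valuation ring of a finite extension `K` of `ℚ_p`, realized as the integral
closure of `ℤ_p` in `K`. -/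
abbrev PadicValRing (p : ℕ) [Fact p.Prime] (K : Type) [Field K] [Algebra ℚ_[p] K]
    [Algebra ℤ_[p] K] [IsScalarTower ℤ_[p] ℚ_[p] K] : Type :=
  integralClosure ℤ_[p] K

/-- The formal power series ring `Λ = O⟦t₁, …, t_r⟧` over the valuation ring `O`. -/
abbrev IwasawaAlgebra (p : ℕ) [Fact p.Prime] (K : Type) [Field K] [Algebra ℚ_[p] K]
    [Algebra ℤ_[p] K] [IsScalarTower ℤ_[p] ℚ_[p] K] (r : ℕ) : Type :=
  MvPowerSeries (Fin r) (PadicValRing p K)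

/-- `Ext^i_R(M, N)`, as a type (carrying its natural `R`-module structure). -/
abbrev ExtGroup (R : Type) [CommRing R] (i : ℕ) (M N : Type) [AddCommGroup M] [Module R M]
    [AddCommGroup N] [Module R N] : Type :=
  ((Ext R (ModuleCat R) i).obj (op (ModuleCat.of R M))).obj (ModuleCat.of R N)

/-- The height of an ideal: the infimum of the heights of the prime ideals containing it. -/
noncomputable def idealHeight {R : Type} [CommRing R] (I : Ideal R) : ℕ∞ :=
  ⨅ P : {P : PrimeSpectrum R // I ≤ P.asIdeal}, Order.height P.1


section RingO
variable (p : ℕ) [Fact p.Prime] (K : Type) [Field K] [Algebra ℚ_[p] K]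
    [Algebra ℤ_[p] K] [IsScalarTower ℤ_[p] ℚ_[p] K] [FiniteDimensional ℚ_[p] K]

theorem aux_integral_iff (x : K) : IsIntegral ℤ_[p] x ↔ spectralNorm ℚ_[p] K x ≤ 1 := by
  have hx : IsIntegral ℚ_[p] x := Algebra.IsIntegral.isIntegral x
  rw [spectralNorm, spectralValue_le_one_iff (minpoly.monic hx)]
  constructor
  · intro h n
    rw [minpoly.isIntegrallyClosed_eq_field_fractions' ℚ_[p] h, Polynomial.coeff_map]
    exact PadicInt.norm_le_one _
  · intro h
    have hl : minpoly ℚ_[p] x ∈ Polynomial.lifts (algebraMap ℤ_[p] ℚ_[p]) := by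
      rw [Polynomial.lifts_iff_coeff_lifts]
      intro n
      exact ⟨⟨_, h n⟩, rfl⟩
    obtain ⟨q, hq, -, hqm⟩ := Polynomial.lifts_and_natDegree_eq_and_monic hl (minpoly.monic hx)
    refine ⟨q, hqm, ?_⟩
    have : Polynomial.aeval x (q.map (algebraMap ℤ_[p] ℚ_[p])) = 0 := by
      rw [hq]; exact minpoly.aeval _ _
    rwa [Polynomial.aeval_map_algebraMap] at this

theorem aux_isUnit_iff (a : PadicValRing p K) :
    IsUnit a ↔ spectralNorm ℚ_[p] K (a : K) = 1 := by
  have hle : ∀ a : PadicValRing p K, spectralNorm ℚ_[p] K (a : K) ≤ 1 :=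
    fun a => (aux_integral_iff p K a).1 a.2
  have hmul : ∀ x y : K, spectralNorm ℚ_[p] K (x * y) =
    spectralNorm ℚ_[p] K x * spectralNorm ℚ_[p] K y := fun x y =>
      map_mul (spectralMulAlgNorm ℚ_[p] K) x y
  have hone : spectralNorm ℚ_[p] K (1 : K) = 1 := spectralNorm_one
  constructor
  · intro h
    obtain ⟨b, hb⟩ := h.exists_right_inv
    have h1 : spectralNorm ℚ_[p] K (a : K) * spectralNorm ℚ_[p] K (b : K) = 1 := by
      rw [← hmul, ← hone]; congr 1; exact_mod_cast congrArg Subtype.val hb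
    have := hle a
    have := hle b
    have := spectralNorm_nonneg (K := ℚ_[p]) (b : K)
    have := spectralNorm_nonneg (K := ℚ_[p]) (a : K)
    nlinarith
  · intro h
    have ha : (a : K) ≠ 0 := by
      intro h0; rw [h0, spectralNorm_zero] at h; exact zero_ne_one h
    have h1 : spectralNorm ℚ_[p] K (a : K) * spectralNorm ℚ_[p] K ((a : K)⁻¹) = 1 := by
      rw [← hmul, mul_inv_cancel₀ ha, hone]
    rw [h, one_mul] at h1
    refine IsUnit.of_mul_eq_one ⟨(a : K)⁻¹, (aux_integral_iff p K _).2 h1.le⟩ ?_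
    ext
    exact mul_inv_cancel₀ ha

instance aux_isLocalRing : IsLocalRing (PadicValRing p K) := by
  refine IsLocalRing.of_nonunits_add ?_
  intro a b ha hb
  have hle : ∀ a : PadicValRing p K, spectralNorm ℚ_[p] K (a : K) ≤ 1 :=
    fun a => (aux_integral_iff p K a).1 a.2
  rw [mem_nonunits_iff, aux_isUnit_iff] at *
  have := isNonarchimedean_spectralNorm (K := ℚ_[p]) (L := K) (a : K) (b : K)
  have h1 := lt_of_le_of_ne (hle a) ha
  have h2 := lt_of_le_of_ne (hle b) hb
  exact (this.trans_lt (max_lt h1 h2)).ne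

instance aux_dedekind : IsDedekindDomain (PadicValRing p K) :=
  have : CharZero K := charZero_of_injective_algebraMap (algebraMap ℚ_[p] K).injective
  integralClosure.isDedekindDomain ℤ_[p] ℚ_[p] K

instance aux_finite : Module.Finite ℤ_[p] (PadicValRing p K) :=
  IsIntegralClosure.finite ℤ_[p] ℚ_[p] K _

theorem aux_p_mem : (algebraMap ℤ_[p] (PadicValRing p K) (p : ℤ_[p])) ∈
    IsLocalRing.maximalIdeal (PadicValRing p K) := by
  rw [IsLocalRing.mem_maximalIdeal, mem_nonunits_iff, aux_isUnit_iff]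
  have : ((algebraMap ℤ_[p] (PadicValRing p K) (p : ℤ_[p]) : PadicValRing p K) : K) =
    algebraMap ℚ_[p] K (p : ℚ_[p]) := by simp
  rw [this, spectralNorm_extends]
  simp only [Padic.norm_p]
  have := (Fact.out : p.Prime).one_lt
  intro h
  rw [inv_eq_one] at h
  norm_cast at h
  omega

theorem aux_residue_finite : Finite (IsLocalRing.ResidueField (PadicValRing p K)) := by
  have hM : Module.Finite ℤ_[p] (IsLocalRing.ResidueField (PadicValRing p K)) :=
    Module.Finite.of_surjective
      (Algebra.linearMap (PadicValRing p K)
        (IsLocalRing.ResidueField (PadicValRing p K)) |>.restrictScalars ℤ_[p])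
      IsLocalRing.residue_surjective
  have : IsLocalHom (algebraMap ℤ_[p] (PadicValRing p K)) := by
    refine ⟨fun a ha => ?_⟩
    by_contra hna
    have : a ∈ IsLocalRing.maximalIdeal ℤ_[p] := hna
    rw [PadicInt.maximalIdeal_eq_span_p, Ideal.mem_span_singleton] at this
    obtain ⟨c, rfl⟩ := this
    rw [map_mul] at ha
    exact aux_p_mem p K (isUnit_of_mul_isUnit_left ha)
  have : Finite (IsLocalRing.ResidueField ℤ_[p]) :=
    Finite.of_equiv _ (PadicInt.residueField (p := p)).symm.toEquiv
  have : Module.Finite (IsLocalRing.ResidueField ℤ_[p])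
      (IsLocalRing.ResidueField (PadicValRing p K)) := by
    infer_instance
  exact Module.finite_of_finite (IsLocalRing.ResidueField ℤ_[p])

theorem aux_unif : ∃ ϖ : PadicValRing p K, ϖ ≠ 0 ∧
    IsLocalRing.maximalIdeal (PadicValRing p K) = Ideal.span {ϖ} := by
  have : IsPrincipalIdealRing (PadicValRing p K) := by infer_instance
  obtain ⟨ϖ, h⟩ := this.principal (IsLocalRing.maximalIdeal (PadicValRing p K))
  refine ⟨ϖ, ?_, h⟩
  rintro rfl
  have hp := aux_p_mem p K
  rw [h] at hp
  simp at hp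
  have h0 : algebraMap ℚ_[p] K (p : ℚ_[p]) = 0 := by
    have := congrArg Subtype.val hp
    simpa using this
  rw [map_eq_zero] at h0
  exact (Fact.out : p.Prime).ne_zero (by exact_mod_cast h0)

end RingO

section Homological
variable (R : Type) [CommRing R]

/-- `Ext^n(N, R)` in the derived-category version. -/
abbrev EE (n : ℕ) (N : Type) [AddCommGroup N] [Module R N] : Type :=
  Abelian.Ext (ModuleCat.of R N) (ModuleCat.of R R) n

variable {R}
variable {A B C : Type} [AddCommGroup A] [Module R A] [AddCommGroup B] [Module R B]
  [AddCommGroup C] [Module R C]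

/-- the short complex of an exact pair -/
abbrev scOf (f : A →ₗ[R] B) (g : B →ₗ[R] C) (h : Function.Exact f g) :
    ShortComplex (ModuleCat R) :=
  ShortComplex.mk (ModuleCat.ofHom f) (ModuleCat.ofHom g)
    (by ext x; exact h.apply_apply_eq_zero x)

theorem scOf_shortExact (f : A →ₗ[R] B) (g : B →ₗ[R] C) (hf : Function.Injective f)
    (h : Function.Exact f g) (hg : Function.Surjective g) : (scOf f g h).ShortExact where
  exact := by
    rw [ShortComplex.ShortExact.moduleCat_exact_iff_function_exact]
    exact h
  mono_f := (ModuleCat.mono_iff_injective _).2 hf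
  epi_g := (ModuleCat.epi_iff_surjective _).2 hg

theorem ee_conn (f : A →ₗ[R] B) (g : B →ₗ[R] C) (hf : Function.Injective f)
    (h : Function.Exact f g) (hg : Function.Surjective g) (n : ℕ)
    (h1 : Subsingleton (EE R n B)) (h2 : Subsingleton (EE R (n + 1) B)) :
    Nonempty (EE R n A ≃ₗ[R] EE R (n + 1) C) := by
  have hS := scOf_shortExact f g hf h hg
  refine ⟨LinearEquiv.ofBijective
    (hS.extClass.precompOfLinear R (ModuleCat.of R R) (add_comm 1 n)) ⟨?_, ?_⟩⟩
  · rw [injective_iff_map_eq_zero]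
    intro x hx
    obtain ⟨y, hy⟩ := Abelian.Ext.contravariant_sequence_exact₁ hS _ x (add_comm 1 n) hx
    rw [← hy, h1.elim y 0, Abelian.Ext.comp_zero]
  · intro x
    exact Abelian.Ext.contravariant_sequence_exact₃ hS _ x (h2.elim _ _) (add_comm 1 n)

theorem ee_mid (f : A →ₗ[R] B) (g : B →ₗ[R] C) (hf : Function.Injective f)
    (h : Function.Exact f g) (hg : Function.Surjective g) (n : ℕ)
    (h1 : Subsingleton (EE R n A)) (h2 : Subsingleton (EE R n C)) :
    Subsingleton (EE R n B) := by
  have hS := scOf_shortExact f g hf h hg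
  refine subsingleton_of_forall_eq 0 fun x => ?_
  obtain ⟨y, hy⟩ := Abelian.Ext.contravariant_sequence_exact₂ hS _ x (h1.elim _ _)
  rw [← hy, h2.elim y 0, Abelian.Ext.comp_zero]

theorem ee_mid_finite (f : A →ₗ[R] B) (g : B →ₗ[R] C) (hf : Function.Injective f)
    (h : Function.Exact f g) (hg : Function.Surjective g) (n : ℕ)
    (h1 : Finite (EE R n A)) (h2 : Finite (EE R n C)) :
    Finite (EE R n B) := by
  have hS := scOf_shortExact f g hf h hg
  let φ := (Abelian.Ext.mk₀ (scOf f g h).g).precompOfLinear R (ModuleCat.of R R) (zero_add n)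
  let ψ := (Abelian.Ext.mk₀ (scOf f g h).f).precompOfLinear R (ModuleCat.of R R) (zero_add n)
  have hex : LinearMap.ker ψ ≤ LinearMap.range φ := fun x hx =>
    Abelian.Ext.contravariant_sequence_exact₂ hS _ x hx
  have : Finite (LinearMap.range φ) := Finite.of_surjective _ φ.surjective_rangeRestrict
  have : Finite (LinearMap.ker ψ) := Finite.of_injective _ (Submodule.inclusion_injective hex)
  have : Finite (EE R n B ⧸ LinearMap.ker ψ) :=
    Finite.of_injective _ (LinearMap.ker_eq_bot.1 (Submodule.ker_liftQ_eq_bot _ ψ le_rfl le_rfl))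
  have h3 : Finite (EE R n B ⧸ (LinearMap.ker ψ).toAddSubgroup) := this
  have h4 : Finite (LinearMap.ker ψ).toAddSubgroup := ‹Finite (LinearMap.ker ψ)›
  have h5 := Finite.instProd (α := EE R n B ⧸ (LinearMap.ker ψ).toAddSubgroup)
    (β := (LinearMap.ker ψ).toAddSubgroup)
  exact @Finite.of_equiv _ _ h5 (AddSubgroup.addGroupEquivQuotientProdAddSubgroup
    (s := (LinearMap.ker ψ).toAddSubgroup)).symm

theorem ee_left (f : A →ₗ[R] B) (g : B →ₗ[R] C) (hf : Function.Injective f)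
    (h : Function.Exact f g) (hg : Function.Surjective g) (n : ℕ)
    (h1 : Subsingleton (EE R n B)) (h2 : Subsingleton (EE R (n + 1) C)) :
    Subsingleton (EE R n A) := by
  have hS := scOf_shortExact f g hf h hg
  refine subsingleton_of_forall_eq 0 fun x => ?_
  obtain ⟨y, hy⟩ := Abelian.Ext.contravariant_sequence_exact₁ hS _ x (add_comm 1 n) (h2.elim _ _)
  rw [← hy, h1.elim y 0, Abelian.Ext.comp_zero]

theorem ee_right (f : A →ₗ[R] B) (g : B →ₗ[R] C) (hf : Function.Injective f)
    (h : Function.Exact f g) (hg : Function.Surjective g) (n : ℕ)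
    (h1 : Subsingleton (EE R n A)) (h2 : Subsingleton (EE R (n + 1) B)) :
    Subsingleton (EE R (n + 1) C) := by
  have hS := scOf_shortExact f g hf h hg
  refine subsingleton_of_forall_eq 0 fun x => ?_
  obtain ⟨y, hy⟩ := Abelian.Ext.contravariant_sequence_exact₃ hS _ x (h2.elim _ _) (add_comm 1 n)
  rw [← hy, h1.elim y 0, Abelian.Ext.comp_zero]

theorem ee_nak [IsNoetherianRing R] [IsLocalRing R] [Module.Finite R B] (x : R)
    (hx : x ∈ IsLocalRing.maximalIdeal R) (g : B →ₗ[R] C)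
    (hf : Function.Injective (LinearMap.lsmul R B x))
    (h : Function.Exact (LinearMap.lsmul R B x) g) (hg : Function.Surjective g) (n : ℕ)
    (h2 : Subsingleton (EE R (n + 1) C)) :
    Subsingleton (EE R n B) := by
  have hS := scOf_shortExact _ g hf h hg
  have key : ∀ y : EE R n B, ∃ z : EE R n B, x • z = y := by
    intro y
    obtain ⟨z, hz⟩ := Abelian.Ext.contravariant_sequence_exact₁ hS _ y (add_comm 1 n) (h2.elim _ _)
    refine ⟨z, ?_⟩
    rw [← hz]
    have : (scOf _ g h).f = x • 𝟙 (ModuleCat.of R B) := by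
      ext; rfl
    rw [this, Abelian.Ext.mk₀_smul, Abelian.Ext.smul_comp, Abelian.Ext.mk₀_id_comp]
  have hfin : Module.Finite R (EE R n B) := by
    have : Module.Finite R (ModuleCat.of R B) := ‹Module.Finite R B›
    infer_instance
  have : (⊤ : Submodule R (EE R n B)) = ⊥ := by
    refine Submodule.eq_bot_of_le_smul_of_le_jacobson_bot (IsLocalRing.maximalIdeal R) _
      hfin.1 ?_ (IsLocalRing.maximalIdeal_le_jacobson _)
    intro y _
    obtain ⟨z, rfl⟩ := key y
    exact Submodule.smul_mem_smul hx trivial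
  exact (Submodule.subsingleton_iff R).1 (subsingleton_of_bot_eq_top this.symm)

theorem ee_congr (e : A ≃ₗ[R] B) (n : ℕ) : Nonempty (EE R n A ≃ₗ[R] EE R n B) := by
  refine ⟨LinearEquiv.ofLinearMap
    ((Abelian.Ext.mk₀ (ModuleCat.ofHom e.symm.toLinearMap)).precompOfLinear R
      (ModuleCat.of R R) (zero_add n))
    ((Abelian.Ext.mk₀ (ModuleCat.ofHom e.toLinearMap)).precompOfLinear R
      (ModuleCat.of R R) (zero_add n)) ?_ ?_⟩
  · ext x
    simp [← ModuleCat.ofHom_comp]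
  · ext x
    simp [← ModuleCat.ofHom_comp]

theorem ee_proj (A : Type) [AddCommGroup A] [Module R A] [Module.Projective R A] (n : ℕ) :
    Subsingleton (EE R (n + 1) A) := by
  have : Projective (ModuleCat.of R A) := (IsProjective.iff_projective A).1 inferInstance
  exact Abelian.Ext.subsingleton_of_projective _ _ _

end Homological

section Bridge
variable (R : Type) [CommRing R] (X Y : ModuleCat.{0} R)

theorem extMk_smul' (P : ProjectiveResolution X) (n m : ℕ) (hm : n + 1 = m) (r : R)
    (f : P.complex.X n ⟶ Y) (hf : P.complex.d m n ≫ f = 0)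
    (hrf : P.complex.d m n ≫ (r • f) = 0) :
    P.extMk (r • f) m hm hrf = r • P.extMk f m hm hf := by
  rw [Abelian.Ext.smul_eq_comp_mk₀, P.extMk_comp_mk₀]
  congr 1

/-- cocycles to Ext -/
def cocycleToExt (P : ProjectiveResolution X) (n : ℕ) :
    LinearMap.ker ((P.complex.linearYonedaObj R Y).sc' n (n + 1) (n + 2)).g.hom →ₗ[R]
      Abelian.Ext X Y (n + 1) where
  toFun f := P.extMk (n := n + 1) (show P.complex.X (n + 1) ⟶ Y from f.1) (n + 2) rfl f.2
  map_add' _ _ := (P.add_extMk _ _ _ _ _ _).symm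
  map_smul' r f := extMk_smul' R X Y P (n + 1) (n + 2) rfl r
    (show P.complex.X (n + 1) ⟶ Y from f.1) f.2 (r • f).2

theorem bridge' (P : ProjectiveResolution X) (n : ℕ) :
    Nonempty ((((Ext R (ModuleCat R) (n + 1)).obj (op X)).obj Y) ≃ₗ[R]
      Abelian.Ext X Y (n + 1)) := by
  let c := P.complex.linearYonedaObj R Y
  let S := c.sc' n (n + 1) (n + 2)
  have e1 : c.homology (n + 1) ≅ S.homology :=
    ShortComplex.homologyMapIso (c.isoSc' n (n + 1) (n + 2) (by simp) (by simp))
  have e2 := S.moduleCatHomologyIso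
  have e0 := P.isoExt (R := R) (n + 1) Y
  let φ := cocycleToExt R X Y P n
  have hsurj : Function.Surjective φ := by
    intro α
    obtain ⟨f, hf, h⟩ := P.extMk_surjective α (n + 2) rfl
    exact ⟨⟨f, hf⟩, h⟩
  have hker : LinearMap.range S.moduleCatToCycles = LinearMap.ker φ := by
    ext f
    rw [LinearMap.mem_ker]
    refine Iff.trans ?_ (P.extMk_eq_zero_iff (n := n + 1)
      (show P.complex.X (n + 1) ⟶ Y from f.1) (n + 2) rfl f.2 n rfl).symm
    constructor
    · rintro ⟨g, hg⟩
      exact ⟨g, congrArg Subtype.val hg⟩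
    · rintro ⟨g, hg⟩
      exact ⟨g, Subtype.ext hg⟩
  have e3 := (e0 ≪≫ e1 ≪≫ e2).toLinearEquiv
  exact ⟨e3.trans ((Submodule.quotEquivOfEq _ _ hker).trans (φ.quotKerEquivOfSurjective hsurj))⟩

end Bridge

theorem bridge (R : Type) [CommRing R] (n : ℕ) (M : Type) [AddCommGroup M] [Module R M] :
    Nonempty (ExtGroup R (n + 1) M R ≃ₗ[R] EE R (n + 1) M) :=
  bridge' R _ _ (projectiveResolution (ModuleCat.of R M)) n

section Main
variable {R : Type} [CommRing R]

/-- the projection `R/I → R/(I + x)` -/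
abbrev projQ (I : Ideal R) (x : R) : (R ⧸ I) →ₗ[R] (R ⧸ (I ⊔ Ideal.span {x})) :=
  Submodule.factor le_sup_left

theorem projQ_surj (I : Ideal R) (x : R) : Function.Surjective (projQ I x) :=
  Submodule.factor_surjective _

theorem projQ_inj (I : Ideal R) (x : R) (h : ∀ y, x * y ∈ I → y ∈ I) :
    Function.Injective (LinearMap.lsmul R (R ⧸ I) x) := by
  rw [injective_iff_map_eq_zero]
  intro y hy
  obtain ⟨y, rfl⟩ := Ideal.Quotient.mk_surjective y
  exact Ideal.Quotient.eq_zero_iff_mem.2 (h y (Ideal.Quotient.eq_zero_iff_mem.1 hy))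

theorem projQ_exact (I : Ideal R) (x : R) :
    Function.Exact (LinearMap.lsmul R (R ⧸ I) x) (projQ I x) := by
  intro y
  obtain ⟨y, rfl⟩ := Ideal.Quotient.mk_surjective y
  have h1 : projQ I x (Ideal.Quotient.mk I y) = Ideal.Quotient.mk (I ⊔ Ideal.span {x}) y := rfl
  rw [h1, Ideal.Quotient.eq_zero_iff_mem, Submodule.mem_sup]
  constructor
  · rintro ⟨a, ha, b, hb, rfl⟩
    obtain ⟨c, rfl⟩ := Ideal.mem_span_singleton.1 hb
    refine ⟨Ideal.Quotient.mk I c, ?_⟩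
    rw [map_add, Ideal.Quotient.eq_zero_iff_mem.2 ha, zero_add]
    rfl
  · rintro ⟨c, hc⟩
    obtain ⟨c, rfl⟩ := Ideal.Quotient.mk_surjective c
    have h2 : Ideal.Quotient.mk I (x * c) = Ideal.Quotient.mk I y := hc
    rw [Ideal.Quotient.eq] at h2
    exact ⟨y - x * c, by rw [← neg_sub]; exact I.neg_mem h2, x * c,
      Ideal.mem_span_singleton.2 ⟨c, rfl⟩, by ring⟩

theorem ee_step (I : Ideal R) (x : R) (h : ∀ y, x * y ∈ I → y ∈ I) (d : ℕ)
    (hd : ∀ i, d < i → Subsingleton (EE R i (R ⧸ I))) :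
    ∀ i, d + 1 < i → Subsingleton (EE R i (R ⧸ (I ⊔ Ideal.span {x}))) := by
  intro i hi
  obtain ⟨j, rfl⟩ : ∃ j, i = j + 1 := ⟨i - 1, by omega⟩
  exact ee_right _ _ (projQ_inj I x h) (projQ_exact I x) (projQ_surj I x) j
    (hd j (by omega)) (hd _ (by omega))

variable [IsNoetherianRing R] [IsLocalRing R]

theorem ee_vanish_prime (d : ℕ)
    (hk : ∀ i, d < i → Subsingleton (EE R i (R ⧸ IsLocalRing.maximalIdeal R)))
    (P : Ideal R) : P.IsPrime → ∀ i, d < i → Subsingleton (EE R i (R ⧸ P)) := by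
  induction P using WellFoundedGT.induction with
  | ind P ih =>
  intro hP
  by_cases hPm : P = IsLocalRing.maximalIdeal R
  · subst hPm; exact hk
  have hle := IsLocalRing.le_maximalIdeal hP.ne_top
  obtain ⟨x, hxm, hxP⟩ := SetLike.exists_of_lt (lt_of_le_of_ne hle hPm)
  have key : P ⊔ Ideal.span {x} ≤ Module.annihilator R (R ⧸ (P ⊔ Ideal.span {x})) →
      ∀ i, d < i → Subsingleton (EE R i (R ⧸ (P ⊔ Ideal.span {x}))) := by
    refine IsNoetherianRing.induction_on_isQuotientEquivQuotientPrime R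
      (M := R ⧸ (P ⊔ Ideal.span {x})) inferInstance
      (motive := fun N _ _ _ => P ⊔ Ideal.span {x} ≤ Module.annihilator R N →
        ∀ i, d < i → Subsingleton (EE R i N)) ?_ ?_ ?_
    · intro N _ _ _ _ _ i hi
      obtain ⟨j, rfl⟩ : ∃ j, i = j + 1 := ⟨i - 1, by omega⟩
      exact ee_proj N j
    · intro N _ _ _ q e hN i hi
      rw [e.annihilator_eq, Ideal.annihilator_quotient] at hN
      obtain ⟨e'⟩ := ee_congr e i
      have := ih q.1 (lt_of_le_of_ne (le_sup_left.trans hN) (by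
        rintro rfl
        exact hxP (hN (Ideal.mem_sup_right (Ideal.mem_span_singleton_self x))))) q.2 i hi
      exact e'.toEquiv.subsingleton
    · intro N₁ _ _ _ N₂ _ _ _ N₃ _ _ _ f g hf hg hfg h1 h3 hN i hi
      exact ee_mid f g hf hfg hg i (h1 (hN.trans (f.annihilator_le_of_injective hf)) i hi)
        (h3 (hN.trans (g.annihilator_le_of_surjective hg)) i hi)
  have key' := key (by rw [Ideal.annihilator_quotient])
  intro i hi
  exact ee_nak x hxm _ (projQ_inj P x fun y hy => (hP.mem_or_mem hy).resolve_left hxP)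
    (projQ_exact P x) (projQ_surj P x) i (key' _ (by omega))

theorem ee_vanish (d : ℕ)
    (hk : ∀ i, d < i → Subsingleton (EE R i (R ⧸ IsLocalRing.maximalIdeal R)))
    (N : Type) [AddCommGroup N] [Module R N] [Module.Finite R N] :
    ∀ i, d < i → Subsingleton (EE R i N) := by
  refine IsNoetherianRing.induction_on_isQuotientEquivQuotientPrime R
      (M := N) inferInstance
      (motive := fun N _ _ _ => ∀ i, d < i → Subsingleton (EE R i N)) ?_ ?_ ?_
  · intro N _ _ _ _ i hi
    obtain ⟨j, rfl⟩ : ∃ j, i = j + 1 := ⟨i - 1, by omega⟩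
    exact ee_proj N j
  · intro N _ _ _ q e i hi
    obtain ⟨e'⟩ := ee_congr e i
    have := ee_vanish_prime d hk q.1 q.2 i hi
    exact e'.toEquiv.subsingleton
  · intro N₁ _ _ _ N₂ _ _ _ N₃ _ _ _ f g hf hg hfg h1 h3 i hi
    exact ee_mid f g hf hfg hg i (h1 i hi) (h3 i hi)

theorem ee_finite (d : ℕ) (hd0 : 0 < d) [Finite (IsLocalRing.ResidueField R)]
    (hk : ∀ i, d < i → Subsingleton (EE R i (R ⧸ IsLocalRing.maximalIdeal R)))
    (N : Type) [AddCommGroup N] [Module R N] [Module.Finite R N] :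
    Finite (EE R d N) := by
  refine IsNoetherianRing.induction_on_isQuotientEquivQuotientPrime R
      (M := N) inferInstance
      (motive := fun N _ _ _ => Finite (EE R d N)) ?_ ?_ ?_
  · intro N _ _ _ _
    obtain ⟨j, rfl⟩ : ∃ j, d = j + 1 := ⟨d - 1, by omega⟩
    have := ee_proj (R := R) N j
    infer_instance
  · intro N _ _ _ q e
    obtain ⟨e'⟩ := ee_congr e d
    suffices Finite (EE R d (R ⧸ q.1)) from Finite.of_equiv _ e'.symm.toEquiv
    have hP := q.2
    generalize q.asIdeal = P at hP
    by_cases hPm : P = IsLocalRing.maximalIdeal R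
    · subst hPm
      have hfin : Module.Finite R (EE R d (R ⧸ IsLocalRing.maximalIdeal R)) := by
        have : Module.Finite R (ModuleCat.of R (R ⧸ IsLocalRing.maximalIdeal R)) :=
          inferInstanceAs (Module.Finite R (R ⧸ IsLocalRing.maximalIdeal R))
        infer_instance
      have hann : Module.IsTorsionBySet R (EE R d (R ⧸ IsLocalRing.maximalIdeal R))
          (IsLocalRing.maximalIdeal R) := by
        rintro y ⟨x, hx⟩
        have h0 : x • 𝟙 (ModuleCat.of R (R ⧸ IsLocalRing.maximalIdeal R)) = 0 := by
          refine ModuleCat.hom_ext (LinearMap.ext fun (z : R ⧸ IsLocalRing.maximalIdeal R) => ?_)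
          obtain ⟨z, rfl⟩ := Ideal.Quotient.mk_surjective z
          exact Ideal.Quotient.eq_zero_iff_mem.2 (Ideal.mul_mem_right _ _ hx)
        have h1 : x • y = (Abelian.Ext.mk₀
          (x • 𝟙 (ModuleCat.of R (R ⧸ IsLocalRing.maximalIdeal R)))).comp y (zero_add d) := by
          rw [Abelian.Ext.mk₀_smul, Abelian.Ext.smul_comp, Abelian.Ext.mk₀_id_comp]
        change x • y = 0
        rw [h1, h0, Abelian.Ext.mk₀_zero, Abelian.Ext.zero_comp]
      let _ := hann.module
      have : Finite (R ⧸ IsLocalRing.maximalIdeal R) :=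
        ‹Finite (IsLocalRing.ResidueField R)›
      have : Module.Finite (R ⧸ IsLocalRing.maximalIdeal R)
          (EE R d (R ⧸ IsLocalRing.maximalIdeal R)) := by
        have := hann.isScalarTower (S := R)
        exact Module.Finite.of_restrictScalars_finite R _ _
      exact Module.finite_of_finite (R ⧸ IsLocalRing.maximalIdeal R)
    · have hle := IsLocalRing.le_maximalIdeal hP.ne_top
      obtain ⟨x, hxm, hxP⟩ := SetLike.exists_of_lt (lt_of_le_of_ne hle hPm)
      have := ee_nak x hxm _ (projQ_inj P x fun y hy => (hP.mem_or_mem hy).resolve_left hxP)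
        (projQ_exact P x) (projQ_surj P x) d (ee_vanish d hk _ _ (by omega))
      infer_instance
  · intro N₁ _ _ _ N₂ _ _ _ N₃ _ _ _ f g hf hg hfg h1 h3
    exact ee_mid_finite f g hf hfg hg d h1 h3

end Main

section Dual
variable {R : Type} [CommRing R]

theorem dual_exact {A B C : Type} [AddCommGroup A] [Module R A] [AddCommGroup B] [Module R B]
    [AddCommGroup C] [Module R C] (g : A →ₗ[R] B) (f : B →ₗ[R] C)
    (h : Function.Exact g f) (hf : Function.Surjective f) :
    Function.Exact (f.dualMap) (g.dualMap) := by
  intro u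
  constructor
  · intro hu
    have hk : LinearMap.ker f ≤ LinearMap.ker u := by
      intro x hx
      obtain ⟨y, rfl⟩ := (h x).1 hx
      exact LinearMap.congr_fun hu y
    refine ⟨((LinearMap.ker f).liftQ u hk).comp
      (f.quotKerEquivOfSurjective hf).symm.toLinearMap, ?_⟩
    ext x
    have : (f.quotKerEquivOfSurjective hf).symm (f x) = Submodule.Quotient.mk x := by
      rw [LinearEquiv.symm_apply_eq]; rfl
    simp [LinearMap.dualMap_apply, this]
  · rintro ⟨v, rfl⟩
    ext y
    simp [LinearMap.dualMap_apply, h.apply_apply_eq_zero]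

theorem rangeRestrict_exact {A B C : Type} [AddCommGroup A] [Module R A] [AddCommGroup B]
    [Module R B] [AddCommGroup C] [Module R C] (g : A →ₗ[R] B) (f : B →ₗ[R] C)
    (h : Function.Exact g f) : Function.Exact g f.rangeRestrict := by
  intro x
  rw [← h x]
  exact Subtype.ext_iff

theorem ee_dual_vanish [IsNoetherianRing R] (d : ℕ)
    (hv : ∀ (C : Type) [AddCommGroup C] [Module R C] [Module.Finite R C],
      ∀ i, d < i → Subsingleton (EE R i C))
    (N : Type) [AddCommGroup N] [Module R N] [Module.Finite R N] (i : ℕ) (hi : 0 < i)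
    (hid : d < i + 2) : Subsingleton (EE R i (Module.Dual R N)) := by
  obtain ⟨F, _, _, _, _, f, hf⟩ := Module.exists_finite_presentation R N
  obtain ⟨G, _, _, _, _, g, hg⟩ := Module.exists_finite_presentation R (LinearMap.ker f)
  let g' : G →ₗ[R] F := (LinearMap.ker f).subtype.comp g
  have hex : Function.Exact g' f := by
    rw [LinearMap.exact_iff, LinearMap.range_comp, LinearMap.range_eq_top.2 hg]
    simp
  have hdx := dual_exact g' f hex hf
  have hfin : Module.Finite R (Module.Dual R G) := inferInstance
  obtain ⟨j, rfl⟩ : ∃ j, i = j + 1 := ⟨i - 1, by omega⟩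
  have hQ : Subsingleton (EE R (j + 1 + 1) (LinearMap.range g'.dualMap)) := by
    refine ee_left (LinearMap.range g'.dualMap).subtype (LinearMap.range g'.dualMap).mkQ
      (Submodule.injective_subtype _) (LinearMap.exact_subtype_mkQ _)
      (Submodule.mkQ_surjective _) _ (ee_proj _ _) (hv _ _ (by omega))
  exact ee_left f.dualMap g'.dualMap.rangeRestrict
    (LinearMap.dualMap_injective_of_surjective hf) (rangeRestrict_exact _ _ hdx)
    (LinearMap.surjective_rangeRestrict _) _ (ee_proj _ _) hQ

theorem ee_one_pres {M F : Type} [AddCommGroup M] [Module R M] [AddCommGroup F] [Module R F]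
    [Module.Projective R F] (f : F →ₗ[R] M) (hf : Function.Surjective f) :
    ∃ φ : Module.Dual R (LinearMap.ker f) →ₗ[R] EE R 1 M,
      Function.Surjective φ ∧ Function.Exact (LinearMap.ker f).subtype.dualMap φ := by
  have hS := scOf_shortExact (LinearMap.ker f).subtype f (Submodule.injective_subtype _)
    (LinearMap.exact_subtype_ker_map f) hf
  let φ : Module.Dual R (LinearMap.ker f) →ₗ[R] EE R 1 M :=
    { toFun := fun u => hS.extClass.comp (Abelian.Ext.mk₀ (ModuleCat.ofHom u)) (add_zero 1)
      map_add' := fun u v => by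
        rw [ModuleCat.ofHom_add, Abelian.Ext.mk₀_add, Abelian.Ext.comp_add]
      map_smul' := fun r u => by
        have : ModuleCat.ofHom (r • u) = r • ModuleCat.ofHom u := rfl
        rw [this, Abelian.Ext.mk₀_smul, Abelian.Ext.comp_smul, RingHom.id_apply] }
  have hF : Subsingleton (EE R 1 F) := ee_proj F 0
  refine ⟨φ, ?_, ?_⟩
  · intro x
    obtain ⟨y, hy⟩ := Abelian.Ext.contravariant_sequence_exact₃ hS _ x (hF.elim _ _)
      (add_zero 1)
    obtain ⟨u, rfl⟩ := (Abelian.Ext.mk₀_bijective _ _).2 y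
    exact ⟨u.hom, hy⟩
  · intro u
    constructor
    · intro hu
      obtain ⟨y, hy⟩ := Abelian.Ext.contravariant_sequence_exact₁ hS _ _ (add_zero 1) hu
      obtain ⟨v, rfl⟩ := (Abelian.Ext.mk₀_bijective _ _).2 y
      rw [Abelian.Ext.mk₀_comp_mk₀] at hy
      have := (Abelian.Ext.mk₀_bijective _ _).1 hy
      exact ⟨v.hom, congrArg ModuleCat.Hom.hom this⟩
    · rintro ⟨v, rfl⟩
      have : ModuleCat.ofHom ((LinearMap.ker f).subtype.dualMap v) =
        (scOf (LinearMap.ker f).subtype f (LinearMap.exact_subtype_ker_map f)).f ≫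
          ModuleCat.ofHom v := rfl
      change hS.extClass.comp (Abelian.Ext.mk₀
        (ModuleCat.ofHom ((LinearMap.ker f).subtype.dualMap v))) (add_zero 1) = 0
      rw [this, ← Abelian.Ext.mk₀_comp_mk₀, hS.extClass_comp_assoc]

theorem ee_main [IsNoetherianRing R]
    (hv : ∀ (C : Type) [AddCommGroup C] [Module R C] [Module.Finite R C],
      ∀ i, 3 < i → Subsingleton (EE R i C))
    (M : Type) [AddCommGroup M] [Module R M] [Module.Finite R M] :
    Nonempty (EE R 1 (Module.Dual R M) ≃ₗ[R] EE R 3 (EE R 1 M)) := by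
  obtain ⟨F, _, _, _, _, f, hf⟩ := Module.exists_finite_presentation R M
  obtain ⟨φ, hφs, hφe⟩ := ee_one_pres f hf
  have hdx := dual_exact (LinearMap.ker f).subtype f (LinearMap.exact_subtype_ker_map f) hf
  let ρ : Module.Dual R F →ₗ[R] Module.Dual R (LinearMap.ker f) := (LinearMap.ker f).subtype.dualMap
  have hρs : Function.Surjective (LinearMap.rangeRestrict ρ) :=
    LinearMap.surjective_rangeRestrict ρ
  have hρe : Function.Exact f.dualMap (LinearMap.rangeRestrict ρ) :=
    rangeRestrict_exact _ ρ hdx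
  obtain ⟨e1⟩ := ee_conn (A := Module.Dual R M) (B := Module.Dual R F) (C := LinearMap.range ρ)
    f.dualMap (LinearMap.rangeRestrict ρ)
    (LinearMap.dualMap_injective_of_surjective hf) hρe hρs 1
    (ee_proj (Module.Dual R F) 0) (ee_proj (Module.Dual R F) 1)
  have hex2 : Function.Exact (LinearMap.range ρ).subtype φ := by
    rw [LinearMap.exact_iff] at hφe ⊢
    rw [hφe, Submodule.range_subtype]
  obtain ⟨e2⟩ := ee_conn (A := LinearMap.range ρ) (B := Module.Dual R (LinearMap.ker f))
    (C := EE R 1 M) (LinearMap.range ρ).subtype φ (Submodule.injective_subtype _) hex2 hφs 2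
    (ee_dual_vanish 3 hv _ 2 (by omega) (by omega)) (ee_dual_vanish 3 hv _ 3 (by omega) (by omega))
  exact ⟨e1.trans e2⟩

end Dual

section PS
open MvPowerSeries
variable {O : Type} [CommRing O] [IsDomain O] [IsLocalRing O]

theorem ps_reg2 (y : MvPowerSeries (Fin 2) O)
    (h : (X 1 : MvPowerSeries (Fin 2) O) * y ∈ (⊥ ⊔ Ideal.span {X 0} : Ideal (MvPowerSeries (Fin 2) O))) :
    y ∈ (⊥ ⊔ Ideal.span {X 0} : Ideal (MvPowerSeries (Fin 2) O)) := by
  rw [bot_sup_eq, Ideal.mem_span_singleton, X_dvd_iff] at h ⊢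
  intro m hm
  have := h (Finsupp.single 1 1 + m) (by simp [hm])
  rwa [X, coeff_add_monomial_mul, one_mul] at this

theorem ps_ker (y : MvPowerSeries (Fin 2) O) :
    y ∈ (⊥ ⊔ Ideal.span {X 0} ⊔ Ideal.span {X 1} : Ideal (MvPowerSeries (Fin 2) O)) ↔
      constantCoeff y = 0 := by
  rw [bot_sup_eq, Submodule.mem_sup]
  constructor
  · rintro ⟨a, ha, b, hb, rfl⟩
    obtain ⟨a, rfl⟩ := Ideal.mem_span_singleton.1 ha
    obtain ⟨b, rfl⟩ := Ideal.mem_span_singleton.1 hb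
    simp
  · intro h
    let z : MvPowerSeries (Fin 2) O := fun m => if m 0 = 0 then coeff m y else 0
    have hz : ∀ m, coeff m z = if m 0 = 0 then coeff m y else 0 := fun m => rfl
    refine ⟨y - z, Ideal.mem_span_singleton.2 ?_, z, Ideal.mem_span_singleton.2 ?_, by ring⟩
    · rw [X_dvd_iff]
      intro m hm
      simp [hz, hm]
    · rw [X_dvd_iff]
      intro m hm
      rw [hz]
      split_ifs with h0
      · have : m = 0 := by
          ext i; fin_cases i
          · exact h0
          · exact hm
        subst this
        simpa using h
      · rfl

theorem ps_max (ϖ : O) (h : IsLocalRing.maximalIdeal O = Ideal.span {ϖ}) :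
    (⊥ ⊔ Ideal.span {X 0} ⊔ Ideal.span {X 1} ⊔ Ideal.span {C ϖ} :
      Ideal (MvPowerSeries (Fin 2) O)) = IsLocalRing.maximalIdeal (MvPowerSeries (Fin 2) O) := by
  ext y
  have h1 : y ∈ IsLocalRing.maximalIdeal (MvPowerSeries (Fin 2) O) ↔
      constantCoeff y ∈ Ideal.span {ϖ} := by
    rw [← h, IsLocalRing.mem_maximalIdeal, IsLocalRing.mem_maximalIdeal, mem_nonunits_iff,
      mem_nonunits_iff, isUnit_iff_constantCoeff]
  rw [h1, Ideal.mem_span_singleton, Submodule.mem_sup]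
  constructor
  · rintro ⟨a, ha, b, hb, rfl⟩
    obtain ⟨b, rfl⟩ := Ideal.mem_span_singleton.1 hb
    rw [ps_ker] at ha
    simp [ha]
  · rintro ⟨c, hc⟩
    refine ⟨y - C ϖ * C c, (ps_ker _).2 ?_, C ϖ * C c, Ideal.mem_span_singleton.2 ⟨_, rfl⟩, by ring⟩
    simp [hc]

theorem ps_vanish (ϖ : O) (h0 : ϖ ≠ 0) (h : IsLocalRing.maximalIdeal O = Ideal.span {ϖ}) :
    ∀ i, 3 < i → Subsingleton (EE (MvPowerSeries (Fin 2) O) i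
      (MvPowerSeries (Fin 2) O ⧸ IsLocalRing.maximalIdeal (MvPowerSeries (Fin 2) O))) := by
  rw [← ps_max ϖ h]
  refine ee_step _ _ ?_ 2 (ee_step _ _ ps_reg2 1 (ee_step _ _ ?_ 0 ?_))
  · intro y hy
    rw [ps_ker] at hy ⊢
    simpa [h0] using hy
  · intro y hy
    rw [Ideal.mem_bot] at hy ⊢
    refine (mul_eq_zero.1 hy).resolve_left ?_
    intro h1
    have := congrArg (coeff (Finsupp.single (0 : Fin 2) 1)) h1
    simp at this
  · intro i hi
    obtain ⟨j, rfl⟩ : ∃ j, i = j + 1 := ⟨i - 1, by omega⟩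
    obtain ⟨e⟩ := ee_congr (Submodule.quotEquivOfEqBot
      (⊥ : Ideal (MvPowerSeries (Fin 2) O)) rfl) (j + 1)
    have := ee_proj (R := MvPowerSeries (Fin 2) O) (MvPowerSeries (Fin 2) O) j
    exact e.toEquiv.subsingleton

theorem ps_residue_finite [Finite (IsLocalRing.ResidueField O)] :
    Finite (IsLocalRing.ResidueField (MvPowerSeries (Fin 2) O)) := by
  have : IsLocalHom (constantCoeff : MvPowerSeries (Fin 2) O →+* O) :=
    ⟨fun a ha => isUnit_iff_constantCoeff.2 ha⟩
  exact Finite.of_injective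
    (IsLocalRing.ResidueField.map (constantCoeff : MvPowerSeries (Fin 2) O →+* O))
    (RingHom.injective _)

end PS

/-- For `r = 2`, so that `Λ = O⟦t₁,t₂⟧`, one has, for every finitely
generated `Λ`-module `M` with `M* = Hom_Λ(M,Λ)`: `Ext^2_Λ(M*,Λ) = 0` and
`Ext^1_Λ(M*,Λ) ≅ Ext^3_Λ(Ext^1_Λ(M,Λ),Λ)` as `Λ`-modules; in particular
`Ext^1_Λ(M*,Λ)` is finite. -/
theorem statement7 (p : ℕ) [Fact p.Prime] (K : Type) [Field K] [Algebra ℚ_[p] K]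
    [Algebra ℤ_[p] K] [IsScalarTower ℤ_[p] ℚ_[p] K] [FiniteDimensional ℚ_[p] K]
    (M : Type) [AddCommGroup M] [Module (IwasawaAlgebra p K 2) M]
    [Module.Finite (IwasawaAlgebra p K 2) M] :
    Subsingleton (ExtGroup (IwasawaAlgebra p K 2) 2
      (Module.Dual (IwasawaAlgebra p K 2) M) (IwasawaAlgebra p K 2)) ∧
    Nonempty ((ExtGroup (IwasawaAlgebra p K 2) 1
        (Module.Dual (IwasawaAlgebra p K 2) M) (IwasawaAlgebra p K 2)) ≃ₗ[IwasawaAlgebra p K 2]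
      (ExtGroup (IwasawaAlgebra p K 2) 3
        (ExtGroup (IwasawaAlgebra p K 2) 1 M (IwasawaAlgebra p K 2)) (IwasawaAlgebra p K 2))) ∧
    Finite (ExtGroup (IwasawaAlgebra p K 2) 1
      (Module.Dual (IwasawaAlgebra p K 2) M) (IwasawaAlgebra p K 2)) := by
  obtain ⟨ϖ, h0, hϖ⟩ := aux_unif p K
  have hfr := aux_residue_finite p K
  have hfr' := ps_residue_finite (O := PadicValRing p K)
  have hk := ps_vanish ϖ h0 hϖ
  have hv : ∀ (C : Type) [AddCommGroup C] [Module (IwasawaAlgebra p K 2) C]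
      [Module.Finite (IwasawaAlgebra p K 2) C],
      ∀ i, 3 < i → Subsingleton (EE (IwasawaAlgebra p K 2) i C) := fun C _ _ _ =>
    ee_vanish 3 hk C
  obtain ⟨b1⟩ := bridge (IwasawaAlgebra p K 2) 0 (Module.Dual (IwasawaAlgebra p K 2) M)
  obtain ⟨b2⟩ := bridge (IwasawaAlgebra p K 2) 1 (Module.Dual (IwasawaAlgebra p K 2) M)
  obtain ⟨bM⟩ := bridge (IwasawaAlgebra p K 2) 0 M
  obtain ⟨b3⟩ := bridge (IwasawaAlgebra p K 2) 2
    (ExtGroup (IwasawaAlgebra p K 2) 1 M (IwasawaAlgebra p K 2))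
  obtain ⟨e⟩ := ee_main hv M
  obtain ⟨c⟩ := ee_congr bM 3
  have hfM : Module.Finite (IwasawaAlgebra p K 2) (EE (IwasawaAlgebra p K 2) 1 M) := by
    have : Module.Finite (IwasawaAlgebra p K 2) (ModuleCat.of (IwasawaAlgebra p K 2) M) :=
      ‹Module.Finite (IwasawaAlgebra p K 2) M›
    infer_instance
  have hfin := ee_finite 3 (by omega) hk (EE (IwasawaAlgebra p K 2) 1 M)
  refine ⟨?_, ⟨b1.trans (e.trans (c.symm.trans b3.symm))⟩, ?_⟩
  · have := ee_dual_vanish 3 hv M 2 (by omega) (by omega)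
    exact b2.toEquiv.subsingleton
  · exact Finite.of_equiv _ (b1.trans e).symm.toEquiv
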